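/- arXiv:2502.17884 — 4 statements merged into one kernel-verified Lean document; each statement's English description precedes it below -/
import Mathlib

section
/- There is a constant C ≥ 1, depending only on the root system R and the multiplicity function κ, such that for every x ∈ ℝ^N and r > 0: C^{-1} · r^N · ∏_{α∈R} (|⟨α,x⟩| + r)^{κ(α)} ≤ ω(B(x,r)) ≤ C · r^N · ∏_{α∈R} (|⟨α,x⟩| + r)^{κ(α)}. -/
open MeasureTheory Metric
open scoped ENNReal RealInnerProductSpace NNReal

noncomputable section

variable {N : ℕ}

/-- The reflection `σ_α(x) = x - ⟨α,x⟩ α` associated with a normalized root `α`. -/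
def dunklReflect (α x : EuclideanSpace ℝ (Fin N)) : EuclideanSpace ℝ (Fin N) :=
  x - ⟪α, x⟫ • α

/-- The reflection group `G` generated by the root reflections, realized as the subgroup of
linear isometries of `ℝ^N` whose generators act by the reflection formula. -/
def dunklGroup (Rs : Finset (EuclideanSpace ℝ (Fin N))) :
    Subgroup (EuclideanSpace ℝ (Fin N) ≃ₗᵢ[ℝ] EuclideanSpace ℝ (Fin N)) :=
  Subgroup.closure {σ | ∃ α ∈ Rs, ⇑σ = dunklReflect α}

/-- The Dunkl weight `h_κ(x) = ∏_{α ∈ R} |⟨α,x⟩|^{κ(α)}`. -/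
def dunklWeight (Rs : Finset (EuclideanSpace ℝ (Fin N))) (κ : EuclideanSpace ℝ (Fin N) → ℝ)
    (x : EuclideanSpace ℝ (Fin N)) : ℝ :=
  ∏ α ∈ Rs, |⟪α, x⟫| ^ κ α

/-- The Dunkl measure `dω(x) = h_κ(x) dx`. -/
def dunklMeasure (Rs : Finset (EuclideanSpace ℝ (Fin N)))
    (κ : EuclideanSpace ℝ (Fin N) → ℝ) : Measure (EuclideanSpace ℝ (Fin N)) :=
  volume.withDensity fun x => ENNReal.ofReal (dunklWeight Rs κ x)

/-- The Dunkl metric `d(x,y) = min_{σ ∈ G} ‖x - σ(y)‖`. -/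
def dunklDist (Rs : Finset (EuclideanSpace ℝ (Fin N))) (x y : EuclideanSpace ℝ (Fin N)) : ℝ :=
  ⨅ σ : dunklGroup Rs, ‖x - σ.1 y‖

/-- The Dunkl ball `O(B(x,r)) = {y : d(x,y) < r}`. -/
def dunklBall (Rs : Finset (EuclideanSpace ℝ (Fin N))) (x : EuclideanSpace ℝ (Fin N)) (r : ℝ) :
    Set (EuclideanSpace ℝ (Fin N)) :=
  {y | dunklDist Rs x y < r}

/-- Finitely many nonzero vectors admit a common direction orthogonal to none of them. -/
lemma exists_forall_inner_ne_zero {E : Type*} [NormedAddCommGroup E] [InnerProductSpace ℝ E]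
    (s : Finset E) (hs : ∀ α ∈ s, α ≠ 0) : ∃ v : E, ∀ α ∈ s, ⟪α, v⟫ ≠ (0 : ℝ) := by
  obtain ⟨v, hv⟩ := Module.Dual.exists_forall_ne_zero_of_forall_exists
    (fun α : s => (innerₛₗ ℝ (α : E) : Module.Dual ℝ E))
    (fun α => ⟨α, by simpa using hs α α.2⟩)
  exact ⟨v, fun α hα => by simpa using hv ⟨α, hα⟩⟩

/-- Every ball `B(x,r)` contains a ball of comparable radius on which each `|⟨α,y⟩|`, `α ∈ s`, is
bounded below by a multiple of `|⟨α,x⟩| + r`. -/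
lemma exists_ball_subset_forall_le_abs_inner {E : Type*} [NormedAddCommGroup E]
    [InnerProductSpace ℝ E] (s : Finset E) (hs : ∀ α ∈ s, α ≠ 0) :
    ∃ δ : ℝ, 0 < δ ∧ ∀ (x : E) (r : ℝ), 0 < r → ∃ z : E, ball z (δ * r) ⊆ ball x r ∧
      ∀ y ∈ ball z (δ * r), ∀ α ∈ s, δ * (|⟪α, x⟫| + r) ≤ |⟪α, y⟫| := by
  obtain ⟨w, hw⟩ := exists_forall_inner_ne_zero s hs
  obtain ⟨v, hv, hvn⟩ : ∃ v : E, (∀ α ∈ s, ⟪α, v⟫ ≠ (0 : ℝ)) ∧ s.card * ‖v‖ ≤ 1 / 2 := by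
    have hc : 0 < 2 * ((s.card : ℝ) + 1) * (‖w‖ + 1) := by positivity
    refine ⟨(2 * ((s.card : ℝ) + 1) * (‖w‖ + 1))⁻¹ • w, fun α hα => ?_, ?_⟩
    · rw [real_inner_smul_right]
      exact mul_ne_zero (inv_ne_zero hc.ne') (hw α hα)
    · rw [norm_smul, Real.norm_of_nonneg (inv_nonneg.2 hc.le), ← mul_assoc,
        mul_comm (s.card : ℝ), mul_assoc, inv_mul_le_iff₀ hc]
      nlinarith [norm_nonneg w, (Nat.cast_nonneg s.card : (0 : ℝ) ≤ s.card)]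
  obtain ⟨m, hm, hmv⟩ : ∃ m : ℝ, 0 < m ∧ ∀ α ∈ s, m ≤ |⟪α, v⟫| := by
    obtain ⟨B, hB⟩ := (s.image fun α => |⟪α, v⟫|⁻¹).exists_le
    refine ⟨(max B 1)⁻¹, by positivity, fun α hα => ?_⟩
    exact inv_le_of_inv_le₀ (abs_pos.2 (hv α hα))
      ((hB _ (Finset.mem_image_of_mem _ hα)).trans (le_max_left _ _))
  obtain ⟨K, hK, hKs⟩ : ∃ K : ℝ, 0 ≤ K ∧ ∀ α ∈ s, ‖α‖ ≤ K := by
    obtain ⟨B, hB⟩ := (s.image fun α => ‖α‖).exists_le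
    exact ⟨max B 0, le_max_right _ _, fun α hα =>
      (hB _ (Finset.mem_image_of_mem _ hα)).trans (le_max_left _ _)⟩
  have hD : 0 < 4 * (K + 1) + 2 * m := by positivity
  set δ := m / (4 * (K + 1) + 2 * m) with hδ
  have hδ0 : 0 < δ := div_pos hm hD
  have hδD : δ * (4 * (K + 1) + 2 * m) = m := div_mul_cancel₀ _ hD.ne'
  refine ⟨δ, hδ0, fun x r hr => ?_⟩
  -- one of the points `x + j r v`, `0 ≤ j ≤ |s|`, stays away from all the hyperplanes
  obtain ⟨j, hj, hjs⟩ : ∃ j ∈ Finset.range (s.card + 1),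
      ∀ α ∈ s, m * r / 2 ≤ |⟪α, x + ((j : ℝ) * r) • v⟫| := by
    by_contra! hbad
    choose! f hfs hf using hbad
    obtain ⟨i, hi, j, hj, hij, hfij⟩ := Finset.exists_ne_map_eq_of_card_lt_of_maps_to
      (s := Finset.range (s.card + 1)) (t := s) (by simp) hfs
    have h1 := hf i hi
    have h2 := hf j hj
    rw [← hfij] at h2
    have hm' := hmv _ (hfs i hi)
    set α := f i
    rw [inner_add_right, real_inner_smul_right] at h1 h2
    have h3 : |((i : ℝ) - j) * (r * ⟪α, v⟫)| < m * r := by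
      rw [abs_lt] at h1 h2 ⊢
      constructor <;> linarith [h1.1, h1.2, h2.1, h2.2]
    have h4 : (1 : ℝ) ≤ |(i : ℝ) - j| := by
      have : (1 : ℤ) ≤ |(i : ℤ) - j| := Int.one_le_abs (by omega)
      exact_mod_cast this
    rw [abs_mul, abs_mul, abs_of_pos hr] at h3
    have h5 : m * r ≤ r * |⟪α, v⟫| := by nlinarith
    have h6 : 0 ≤ r * |⟪α, v⟫| := by positivity
    nlinarith
  have hzx : ‖((j : ℝ) * r) • v‖ ≤ r / 2 := by
    have hj' : (j : ℝ) ≤ s.card := by exact_mod_cast Finset.mem_range_succ_iff.1 hj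
    rw [norm_smul, Real.norm_of_nonneg (by positivity)]
    have : (j : ℝ) * ‖v‖ ≤ 1 / 2 := (mul_le_mul_of_nonneg_right hj' (norm_nonneg v)).trans hvn
    nlinarith
  have hδ2 : δ ≤ 1 / 2 := by nlinarith
  have hsub : ball (x + ((j : ℝ) * r) • v) (δ * r) ⊆ ball x r := by
    apply ball_subset_ball'
    rw [dist_eq_norm, add_sub_cancel_left]
    nlinarith
  refine ⟨x + ((j : ℝ) * r) • v, hsub, fun y hy α hα => ?_⟩
  have hlip : ∀ a b : E, ∀ t : ℝ, ‖a - b‖ ≤ t → |⟪α, a⟫| ≤ |⟪α, b⟫| + K * t := fun a b t h => by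
    have h1 : |⟪α, a⟫| - |⟪α, b⟫| ≤ |⟪α, a - b⟫| := by
      rw [inner_sub_right]
      exact abs_sub_abs_le_abs_sub _ _
    have h2 := (abs_real_inner_le_norm α (a - b)).trans
      (mul_le_mul (hKs α hα) h (norm_nonneg _) hK)
    linarith
  have h1 := hlip _ _ _ (mem_ball_iff_norm'.1 hy).le
  have h2 := hlip x y r (mem_ball_iff_norm'.1 (hsub hy)).le
  have h3 := hjs α hα
  have h4 : K * (δ * r) ≤ m * r / 4 := by
    have : K * δ ≤ m / 4 := by nlinarith
    nlinarith
  have h5 : m * r / 4 ≤ |⟪α, y⟫| := by linarith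
  have h6 : δ * (|⟪α, x⟫| + r) ≤ δ * (|⟪α, y⟫| + (K + 1) * r) :=
    mul_le_mul_of_nonneg_left (by linarith) hδ0.le
  have h7 : δ * (K + 1) ≤ m / 4 * (1 - δ) := by nlinarith
  nlinarith [mul_le_mul_of_nonneg_right h7 hr.le]

/-- A weight bounded below by `c` on a ball gives it at least `c` times its Lebesgue measure. -/
lemma ofReal_mul_volume_ball_le_dunklMeasure (Rs : Finset (EuclideanSpace ℝ (Fin N)))
    (κ : EuclideanSpace ℝ (Fin N) → ℝ) {z : EuclideanSpace ℝ (Fin N)} {s c : ℝ}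
    (h : ∀ y ∈ ball z s, c ≤ dunklWeight Rs κ y) :
    ENNReal.ofReal c * volume (ball z s) ≤ dunklMeasure Rs κ (ball z s) := by
  rw [dunklMeasure, withDensity_apply _ measurableSet_ball, ← setLIntegral_const]
  exact setLIntegral_mono' measurableSet_ball fun y hy => ENNReal.ofReal_le_ofReal (h y hy)

/-- A weight bounded above by `c` on a ball gives it at most `c` times its Lebesgue measure. -/
lemma dunklMeasure_ball_le_ofReal_mul_volume (Rs : Finset (EuclideanSpace ℝ (Fin N)))
    (κ : EuclideanSpace ℝ (Fin N) → ℝ) {z : EuclideanSpace ℝ (Fin N)} {s c : ℝ}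
    (h : ∀ y ∈ ball z s, dunklWeight Rs κ y ≤ c) :
    dunklMeasure Rs κ (ball z s) ≤ ENNReal.ofReal c * volume (ball z s) := by
  rw [dunklMeasure, withDensity_apply _ measurableSet_ball, ← setLIntegral_const]
  exact setLIntegral_mono' measurableSet_ball fun y hy => ENNReal.ofReal_le_ofReal (h y hy)

lemma volume_ball_eq_ofReal (z : EuclideanSpace ℝ (Fin N)) {s : ℝ} (hs : 0 < s) :
    volume (ball z s) =
      ENNReal.ofReal (s ^ N * volume.real (ball (0 : EuclideanSpace ℝ (Fin N)) 1)) := by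
  have h := Measure.addHaar_ball_mul_of_pos volume z hs 1
  rw [mul_one, finrank_euclideanSpace_fin] at h
  rw [h, ENNReal.ofReal_mul (by positivity), ofReal_measureReal measure_ball_lt_top.ne]

/-- ω(B(x,r)) ≈ r^N ∏_{α∈R} (|⟨α,x⟩| + r)^{κ(α)}. -/
theorem dunklMeasure_ball_approx
    (Rs : Finset (EuclideanSpace ℝ (Fin N))) (κ : EuclideanSpace ℝ (Fin N) → ℝ)
    (hN : 1 ≤ N)
    (hnorm : ∀ α ∈ Rs, ⟪α, α⟫ = (2 : ℝ))
    (hRinv : ∀ α ∈ Rs, ∀ β ∈ Rs, dunklReflect α β ∈ Rs)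
    (hκ0 : ∀ α ∈ Rs, 0 ≤ κ α)
    (hκinv : ∀ α ∈ Rs, ∀ β ∈ Rs, κ (dunklReflect α β) = κ β) :
    ∃ C : ℝ, 1 ≤ C ∧ ∀ (x : EuclideanSpace ℝ (Fin N)) (r : ℝ), 0 < r →
      ENNReal.ofReal (C⁻¹ * r ^ N * ∏ α ∈ Rs, (|⟪α, x⟫| + r) ^ κ α) ≤
          dunklMeasure Rs κ (ball x r) ∧
        dunklMeasure Rs κ (ball x r) ≤
          ENNReal.ofReal (C * r ^ N * ∏ α ∈ Rs, (|⟪α, x⟫| + r) ^ κ α) := by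
  have hs : ∀ α ∈ Rs, α ≠ 0 := by
    rintro α hα rfl
    simpa using hnorm 0 hα
  obtain ⟨δ, hδ, hball⟩ := exists_ball_subset_forall_le_abs_inner Rs hs
  set M := volume.real (ball (0 : EuclideanSpace ℝ (Fin N)) 1)
  have hM : 0 < M := ENNReal.toReal_pos (measure_ball_pos _ _ one_pos).ne' measure_ball_lt_top.ne
  set a := (∏ α ∈ Rs, δ ^ κ α) * (δ ^ N * M)
  have ha : 0 < a := by positivity
  set b := (∏ α ∈ Rs, (2 : ℝ) ^ κ α) * M
  refine ⟨max 1 (max a⁻¹ b), le_max_left _ _, fun x r hr => ?_⟩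
  set P := ∏ α ∈ Rs, (|⟪α, x⟫| + r) ^ κ α
  have hP : 0 < P := by positivity
  have hscale : ∀ c : ℝ, 0 ≤ c →
      ∏ α ∈ Rs, (c * (|⟪α, x⟫| + r)) ^ κ α = (∏ α ∈ Rs, c ^ κ α) * P := fun c hc => by
    rw [← Finset.prod_mul_distrib]
    exact Finset.prod_congr rfl fun α _ => Real.mul_rpow hc (by positivity)
  constructor
  · obtain ⟨z, hsub, hz⟩ := hball x r hr
    refine le_trans ?_ (measure_mono hsub)
    refine le_trans ?_ (ofReal_mul_volume_ball_le_dunklMeasure Rs κ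
      (c := (∏ α ∈ Rs, δ ^ κ α) * P) fun y hy => ?_)
    · rw [volume_ball_eq_ofReal z (by positivity), ← ENNReal.ofReal_mul (by positivity)]
      apply ENNReal.ofReal_le_ofReal
      calc (max 1 (max a⁻¹ b))⁻¹ * r ^ N * P ≤ a * r ^ N * P := by
            gcongr
            exact inv_le_of_inv_le₀ ha ((le_max_left _ _).trans (le_max_right _ _))
        _ = _ := by simp only [a, mul_pow]; ring
    · rw [← hscale δ hδ.le]
      exact Finset.prod_le_prod (fun α _ => by positivity) fun α hα =>
        Real.rpow_le_rpow (by positivity) (hz y hy α hα) (hκ0 α hα)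
  · refine (dunklMeasure_ball_le_ofReal_mul_volume Rs κ
      (c := (∏ α ∈ Rs, (2 : ℝ) ^ κ α) * P) fun y hy => ?_).trans ?_
    · rw [← hscale 2 zero_le_two]
      refine Finset.prod_le_prod (fun α _ => by positivity) fun α hα =>
        Real.rpow_le_rpow (by positivity) ?_ (hκ0 α hα)
      have hα2 : ‖α‖ ≤ 2 := by
        have := hnorm α hα
        rw [real_inner_self_eq_norm_sq] at this
        nlinarith [norm_nonneg α]
      have h1 : |⟪α, y - x⟫| ≤ 2 * r := (abs_real_inner_le_norm _ _).trans
        (mul_le_mul hα2 (mem_ball_iff_norm.1 hy).le (norm_nonneg _) zero_le_two)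
      have h2 : |⟪α, y⟫| - |⟪α, x⟫| ≤ |⟪α, y - x⟫| := by
        rw [inner_sub_right]
        exact abs_sub_abs_le_abs_sub _ _
      linarith [abs_nonneg (⟪α, x⟫ : ℝ)]
    · rw [volume_ball_eq_ofReal x hr, ← ENNReal.ofReal_mul (by positivity)]
      apply ENNReal.ofReal_le_ofReal
      calc (∏ α ∈ Rs, (2 : ℝ) ^ κ α) * P * (r ^ N * M) = b * r ^ N * P := by simp only [b]; ring
        _ ≤ _ := by
            gcongr
            exact (le_max_right _ _).trans (le_max_right _ _)
end
end

section
/- The Dunkl measure ω is doubling: there exists a constant C > 0, depending only on the root system R and the multiplicity function κ, such that ω(B(x, 2r)) ≤ C · ω(B(x, r)) for every x ∈ ℝ^N and r > 0. -/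
open MeasureTheory Metric
open scoped ENNReal RealInnerProductSpace NNReal

noncomputable section

variable {N : ℕ}

theorem norm_le_of_inner_self_eq_two {α : EuclideanSpace ℝ (Fin N)} (h : ⟪α, α⟫ = (2 : ℝ)) :
    ‖α‖ ≤ 3 / 2 := by
  rw [real_inner_self_eq_norm_sq] at h
  nlinarith [norm_nonneg α]

/-- Every ball of radius `r` contains, within half its radius, a point whose distance to the
hyperplanes orthogonal to finitely many normalized vectors is at least a fixed multiple of `r`. -/
theorem exists_forall_le_abs_inner (S : Finset (EuclideanSpace ℝ (Fin N)))
    (hnorm : ∀ α ∈ S, ⟪α, α⟫ = (2 : ℝ)) :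
    ∃ c : ℝ, 0 < c ∧ c ≤ 1 ∧ ∀ (x : EuclideanSpace ℝ (Fin N)) (r : ℝ), 0 < r →
      ∃ z, ‖z - x‖ ≤ r / 2 ∧ ∀ α ∈ S, c * r ≤ |⟪α, z⟫| := by
  classical
  induction S using Finset.induction_on with
  | empty => exact ⟨1, one_pos, le_rfl, fun x r hr => ⟨x, by simpa using (half_pos hr).le, by simp⟩⟩
  | insert β S _ ih =>
    obtain ⟨c, hc, hc1, h⟩ := ih fun α hα => hnorm α (Finset.mem_insert_of_mem hα)
    have hβ := hnorm β (Finset.mem_insert_self β S)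
    have norm_le : ∀ α ∈ insert β S, ‖α‖ ≤ 3 / 2 := fun α hα =>
      norm_le_of_inner_self_eq_two (hnorm α hα)
    refine ⟨c / 8, by positivity, by linarith, fun x r hr => ?_⟩
    obtain ⟨z, hzx, hz⟩ := h x (r / 2) (by positivity)
    have hcr : 0 < c * r := mul_pos hc hr
    by_cases hzβ : c / 8 * r ≤ |⟪β, z⟫|
    · refine ⟨z, by linarith, fun α hα => ?_⟩
      rcases Finset.mem_insert.1 hα with rfl | hα
      · exact hzβ
      · linarith [hz α hα]
    · push Not at hzβ
      refine ⟨z + (c * r / 8) • β, ?_, fun α hα => ?_⟩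
      · have h1 : ‖(c * r / 8) • β‖ ≤ r / 4 := by
          rw [norm_smul, Real.norm_of_nonneg (by positivity)]
          nlinarith [norm_le β (Finset.mem_insert_self β S), norm_nonneg β]
        have h2 : z + (c * r / 8) • β - x = (z - x) + (c * r / 8) • β := by abel
        rw [h2]
        linarith [norm_add_le (z - x) ((c * r / 8) • β)]
      · rw [inner_add_right, real_inner_smul_right]
        rcases Finset.mem_insert.1 hα with rfl | hαS
        · rw [hβ]
          refine le_trans ?_ (le_abs_self _)
          linarith [(abs_lt.1 hzβ).1]
        · have h1 : |c * r / 8 * ⟪α, β⟫| ≤ c * r / 8 * (9 / 4) := by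
            rw [abs_mul, abs_of_pos (by positivity : 0 < c * r / 8)]
            gcongr
            refine (abs_real_inner_le_norm α β).trans ?_
            nlinarith [norm_le α hα, norm_le β (Finset.mem_insert_self β S), norm_nonneg α,
              norm_nonneg β]
          have h2 := abs_sub_abs_le_abs_sub (⟪α, z⟫) (-(c * r / 8 * ⟪α, β⟫))
          rw [sub_neg_eq_add, abs_neg] at h2
          linarith [hz α hαS]

/-- A uniform bound between the root pairings of two points gives one between their weights. -/
theorem dunklWeight_le_of_abs_inner_le {S : Finset (EuclideanSpace ℝ (Fin N))}
    {κ : EuclideanSpace ℝ (Fin N) → ℝ} (hκ0 : ∀ α ∈ S, 0 ≤ κ α) {A : ℝ} (hA : 0 ≤ A)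
    {w y : EuclideanSpace ℝ (Fin N)} (h : ∀ α ∈ S, |⟪α, w⟫| ≤ A * |⟪α, y⟫|) :
    dunklWeight S κ w ≤ (∏ α ∈ S, A ^ κ α) * dunklWeight S κ y := by
  unfold dunklWeight
  rw [← Finset.prod_mul_distrib]
  refine Finset.prod_le_prod (fun α _ => by positivity) fun α hα => ?_
  rw [← Real.mul_rpow hA (abs_nonneg _)]
  exact Real.rpow_le_rpow (abs_nonneg _) (h α hα) (hκ0 α hα)

/-- The Dunkl measure is doubling. -/
theorem dunklMeasure_doubling
    (Rs : Finset (EuclideanSpace ℝ (Fin N))) (κ : EuclideanSpace ℝ (Fin N) → ℝ)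
    (hN : 1 ≤ N)
    (hnorm : ∀ α ∈ Rs, ⟪α, α⟫ = (2 : ℝ))
    (hRinv : ∀ α ∈ Rs, ∀ β ∈ Rs, dunklReflect α β ∈ Rs)
    (hκ0 : ∀ α ∈ Rs, 0 ≤ κ α)
    (hκinv : ∀ α ∈ Rs, ∀ β ∈ Rs, κ (dunklReflect α β) = κ β) :
    ∃ C : ℝ, 0 < C ∧ ∀ (x : EuclideanSpace ℝ (Fin N)) (r : ℝ), 0 < r →
      dunklMeasure Rs κ (ball x (2 * r)) ≤ ENNReal.ofReal C * dunklMeasure Rs κ (ball x r) := by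
  obtain ⟨c, hc, hc1, hpt⟩ := exists_forall_le_abs_inner Rs hnorm
  set A : ℝ := 1 + 12 / c with hAdef
  have hA : 0 < A := by positivity
  set K : ℝ := ∏ α ∈ Rs, A ^ κ α
  have hK : 0 < K := Finset.prod_pos fun α _ => Real.rpow_pos_of_pos hA _
  refine ⟨K * K * (8 / c) ^ N, by positivity, fun x r hr => ?_⟩
  obtain ⟨z, hzx, hz⟩ := hpt x r hr
  have hcr : 0 < c * r := mul_pos hc hr
  have norm_le : ∀ α ∈ Rs, ‖α‖ ≤ 3 / 2 := fun α hα =>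
    norm_le_of_inner_self_eq_two (hnorm α hα)
  have inner_le : ∀ α ∈ Rs, ∀ v w : EuclideanSpace ℝ (Fin N),
      |⟪α, v⟫| ≤ |⟪α, w⟫| + 3 / 2 * ‖v - w‖ := fun α hα v w => by
    have h1 := abs_sub_abs_le_abs_sub (⟪α, v⟫) (⟪α, w⟫)
    rw [← inner_sub_right] at h1
    have h2 := (abs_real_inner_le_norm α (v - w)).trans
      (mul_le_mul_of_nonneg_right (norm_le α hα) (norm_nonneg _))
    linarith
  have hsub : ball z (c * r / 4) ⊆ ball x r := ball_subset_ball' <| by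
    rw [dist_eq_norm]
    nlinarith
  have hcomp : ∀ w ∈ ball x (2 * r), ∀ y ∈ ball z (c * r / 4),
      dunklWeight Rs κ w ≤ K * dunklWeight Rs κ y := fun w hw y hy => by
    refine dunklWeight_le_of_abs_inner_le hκ0 hA.le fun α hα => ?_
    have hyx := hsub hy
    rw [mem_ball, dist_eq_norm] at hw hy hyx
    have h1 : c * r / 2 ≤ |⟪α, y⟫| := by
      have := inner_le α hα z y
      rw [norm_sub_rev] at this
      linarith [hz α hα]
    have h2 : ‖w - y‖ ≤ 3 * r := by
      have := norm_sub_le_norm_sub_add_norm_sub w x y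
      rw [norm_sub_rev x y] at this
      linarith
    have h3 : 12 / c * (c * r / 2) ≤ 12 / c * |⟪α, y⟫| := by gcongr
    have h4 : 12 / c * (c * r / 2) = 6 * r := by field_simp; norm_num
    rw [hAdef]
    linarith [inner_le α hα w y]
  have hzx' : z ∈ ball x (2 * r) := by
    rw [mem_ball, dist_eq_norm]
    linarith
  have hzz : z ∈ ball z (c * r / 4) := mem_ball_self (by positivity)
  set m : ℝ := dunklWeight Rs κ z
  have hm : 0 ≤ m := Finset.prod_nonneg fun α _ => by positivity
  have hupper : dunklMeasure Rs κ (ball x (2 * r)) ≤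
      ENNReal.ofReal (K * m) * volume (ball x (2 * r)) := by
    rw [dunklMeasure, withDensity_apply _ measurableSet_ball, ← setLIntegral_const]
    exact setLIntegral_mono' measurableSet_ball fun w hw =>
      ENNReal.ofReal_le_ofReal (hcomp w hw z hzz)
  have hlower : ENNReal.ofReal m * volume (ball z (c * r / 4)) ≤
      ENNReal.ofReal K * dunklMeasure Rs κ (ball x r) := by
    refine le_trans ?_ (mul_le_mul_right (measure_mono hsub) _)
    rw [dunklMeasure, withDensity_apply _ measurableSet_ball, ← setLIntegral_const,
      ← lintegral_const_mul' _ _ ENNReal.ofReal_ne_top]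
    refine setLIntegral_mono' measurableSet_ball fun y hy => ?_
    rw [← ENNReal.ofReal_mul hK.le]
    exact ENNReal.ofReal_le_ofReal (hcomp z hzx' y hy)
  have hvol : volume (ball x (2 * r)) =
      ENNReal.ofReal ((8 / c) ^ N) * volume (ball z (c * r / 4)) := by
    have h1 : 2 * r = 8 / c * (c * r / 4) := by field_simp; norm_num
    rw [h1, Measure.addHaar_ball_mul_of_pos _ _ (by positivity), finrank_euclideanSpace_fin,
      Measure.addHaar_ball_center volume z]
  calc dunklMeasure Rs κ (ball x (2 * r))
      ≤ ENNReal.ofReal (K * m) * volume (ball x (2 * r)) := hupper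
    _ = ENNReal.ofReal K * ENNReal.ofReal ((8 / c) ^ N) *
          (ENNReal.ofReal m * volume (ball z (c * r / 4))) := by
        rw [hvol, ENNReal.ofReal_mul hK.le]
        ring
    _ ≤ ENNReal.ofReal K * ENNReal.ofReal ((8 / c) ^ N) *
          (ENNReal.ofReal K * dunklMeasure Rs κ (ball x r)) := by gcongr
    _ = ENNReal.ofReal (K * K * (8 / c) ^ N) * dunklMeasure Rs κ (ball x r) := by
        rw [ENNReal.ofReal_mul (by positivity), ENNReal.ofReal_mul hK.le]
        ring
end
end

section
/- There exists a constant C ≥ 1, depending only on the root system R and the multiplicity function κ, such that for all x, y ∈ ℝ^N and r > 0 with ‖x − y‖ ≤ r, one has C^{-1} · ω(B(y,r)) ≤ ω(B(x,r)) ≤ C · ω(B(y,r)). -/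
open MeasureTheory Metric
open scoped ENNReal RealInnerProductSpace NNReal

noncomputable section

variable {N : ℕ}

/-- Every ball contains a smaller ball of comparable radius on which `|⟪α, ·⟫|` is bounded below
by a multiple of the radius. -/
theorem exists_subball_le_abs_inner {E : Type*} [NormedAddCommGroup E] [InnerProductSpace ℝ E]
    {α : E} (hα : α ≠ 0) :
    ∃ c : ℝ, 0 < c ∧ c ≤ 1 ∧ ∀ (y : E) (r : ℝ), 0 < r →
      ∃ w : E, ball w (c * r) ⊆ ball y r ∧ ∀ z ∈ ball w (c * r), c * r ≤ |⟪α, z⟫| := by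
  have hn : 0 < ‖α‖ := norm_pos_iff.2 hα
  have hc4 : min (1 / 4) (‖α‖ / 4) ≤ 1 / 4 := min_le_left _ _
  have hcα : min (1 / 4) (‖α‖ / 4) ≤ ‖α‖ / 4 := min_le_right _ _
  have hc0 : 0 < min (1 / 4) (‖α‖ / 4) := by positivity
  generalize min (1 / 4) (‖α‖ / 4) = c at hc4 hcα hc0
  refine ⟨c, hc0, by linarith, fun y r hr => ?_⟩
  obtain ⟨s, hs, hsy⟩ : ∃ s : ℝ, |s| = r / (2 * ‖α‖) ∧
      r * ‖α‖ / 2 ≤ |⟪α, y + s • α⟫| := by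
    have hmul : r / (2 * ‖α‖) * (‖α‖ * ‖α‖) = r * ‖α‖ / 2 := by field_simp
    have hp : 0 < r / (2 * ‖α‖) := by positivity
    rcases le_total 0 ⟪α, y⟫ with h | h
    · refine ⟨r / (2 * ‖α‖), abs_of_pos hp, le_trans ?_ (le_abs_self _)⟩
      rw [inner_add_right, real_inner_smul_right, real_inner_self_eq_norm_mul_norm]
      linarith
    · refine ⟨-(r / (2 * ‖α‖)), by rw [abs_neg, abs_of_pos hp], le_trans ?_ (neg_le_abs _)⟩
      rw [inner_add_right, real_inner_smul_right, real_inner_self_eq_norm_mul_norm]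
      linarith
  have hdist : dist (y + s • α) y = r / 2 := by
    rw [dist_eq_norm, add_sub_cancel_left, norm_smul, Real.norm_eq_abs, hs]
    field_simp
  have hcr : c * r ≤ 1 / 4 * r := by gcongr
  refine ⟨y + s • α, ball_subset_ball' (by linarith), fun z hz => ?_⟩
  have hz' : ‖y + s • α - z‖ < c * r := by rwa [← dist_eq_norm, dist_comm]
  have hle : |⟪α, y + s • α⟫| - |⟪α, z⟫| ≤ ‖α‖ * ‖y + s • α - z‖ := by
    refine (abs_sub_abs_le_abs_sub _ _).trans ?_
    rw [← inner_sub_right]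
    exact abs_real_inner_le_norm _ _
  have hmul : ‖α‖ * ‖y + s • α - z‖ ≤ ‖α‖ * (1 / 4 * r) := by
    gcongr
    linarith
  have hcα' : c * r ≤ ‖α‖ / 4 * r := by gcongr
  linarith

/-- Every ball contains a smaller ball of comparable radius that stays away, uniformly in terms of
the radius, from finitely many linear hyperplanes. -/
theorem exists_subball_forall_le_abs_inner {E : Type*} [NormedAddCommGroup E]
    [InnerProductSpace ℝ E] (S : Finset E) (hS : ∀ α ∈ S, α ≠ 0) :
    ∃ c : ℝ, 0 < c ∧ c ≤ 1 ∧ ∀ (y : E) (r : ℝ), 0 < r →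
      ∃ w : E, ball w (c * r) ⊆ ball y r ∧
        ∀ z ∈ ball w (c * r), ∀ α ∈ S, c * r ≤ |⟪α, z⟫| := by
  classical
  induction S using Finset.induction_on with
  | empty => exact ⟨1, one_pos, le_rfl, fun y r _ => ⟨y, by simp⟩⟩
  | insert β S _ ih =>
    obtain ⟨c, hc0, hc1, hc⟩ := ih fun α hα => hS α (Finset.mem_insert_of_mem hα)
    obtain ⟨d, hd0, hd1, hd⟩ := exists_subball_le_abs_inner (hS β (Finset.mem_insert_self _ _))
    refine ⟨d * c, by positivity, mul_le_one₀ hd1 hc0.le hc1, fun y r hr => ?_⟩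
    obtain ⟨w, hwy, hw⟩ := hc y r hr
    obtain ⟨v, hvw, hv⟩ := hd w (c * r) (by positivity)
    rw [← mul_assoc] at hvw hv
    refine ⟨v, hvw.trans hwy, fun z hz α hα => ?_⟩
    rcases Finset.mem_insert.1 hα with rfl | hα
    · exact hv z hz
    · refine le_trans ?_ (hw z (hvw hz) α hα)
      rw [mul_assoc]
      exact mul_le_of_le_one_left (by positivity) hd1

theorem dunklWeight_nonneg (Rs : Finset (EuclideanSpace ℝ (Fin N)))
    (κ : EuclideanSpace ℝ (Fin N) → ℝ) (x : EuclideanSpace ℝ (Fin N)) :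
    0 ≤ dunklWeight Rs κ x :=
  Finset.prod_nonneg fun _ _ => Real.rpow_nonneg (abs_nonneg _) _

/-- If `z` has distance at least of order `‖u - z‖` from all the root hyperplanes, then the weight
at `u` is controlled by the weight at `z`. -/
theorem dunklWeight_le_mul {Rs : Finset (EuclideanSpace ℝ (Fin N))}
    {κ : EuclideanSpace ℝ (Fin N) → ℝ} (hκ0 : ∀ α ∈ Rs, 0 ≤ κ α)
    {u z : EuclideanSpace ℝ (Fin N)} {A : ℝ} (hA : 0 ≤ A)
    (h : ∀ α ∈ Rs, ‖α‖ * ‖u - z‖ ≤ A * |⟪α, z⟫|) :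
    dunklWeight Rs κ u ≤ (∏ α ∈ Rs, (1 + A) ^ κ α) * dunklWeight Rs κ z := by
  rw [dunklWeight, dunklWeight, ← Finset.prod_mul_distrib]
  refine Finset.prod_le_prod (fun _ _ => Real.rpow_nonneg (abs_nonneg _) _) fun α hα => ?_
  rw [← Real.mul_rpow (by positivity) (abs_nonneg _)]
  refine Real.rpow_le_rpow (abs_nonneg _) ?_ (hκ0 α hα)
  have hsub : |⟪α, u⟫| - |⟪α, z⟫| ≤ ‖α‖ * ‖u - z‖ := by
    refine (abs_sub_abs_le_abs_sub _ _).trans ?_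
    rw [← inner_sub_right]
    exact abs_real_inner_le_norm _ _
  linarith [h α hα]

/-- If the weight on a ball is at most `M` times its value at `w`, and the latter is at most `M`
times the weight on `ball w (c * r)`, then the measures of the balls compare accordingly. -/
theorem dunklMeasure_ball_le {Rs : Finset (EuclideanSpace ℝ (Fin N))}
    {κ : EuclideanSpace ℝ (Fin N) → ℝ} {x w : EuclideanSpace ℝ (Fin N)} {c r M : ℝ}
    (hc : 0 < c) (hr : 0 < r) (hM : 0 ≤ M)
    (hx : ∀ u ∈ ball x r, dunklWeight Rs κ u ≤ M * dunklWeight Rs κ w)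
    (hw : ∀ z ∈ ball w (c * r), dunklWeight Rs κ w ≤ M * dunklWeight Rs κ z) :
    dunklMeasure Rs κ (ball x r) ≤
      ENNReal.ofReal (M ^ 2 * c⁻¹ ^ N) * dunklMeasure Rs κ (ball w (c * r)) := by
  have hvol : volume (ball x r) = ENNReal.ofReal (c⁻¹ ^ N) * volume (ball w (c * r)) := by
    rw [Measure.addHaar_ball_of_pos _ x hr,
      Measure.addHaar_ball_of_pos _ w (show 0 < c * r by positivity), ← mul_assoc,
      ← ENNReal.ofReal_mul (by positivity), finrank_euclideanSpace_fin, ← mul_pow,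
      inv_mul_cancel_left₀ hc.ne']
  have hW := dunklWeight_nonneg Rs κ w
  rw [dunklMeasure, withDensity_apply _ measurableSet_ball, withDensity_apply _ measurableSet_ball]
  calc ∫⁻ u in ball x r, ENNReal.ofReal (dunklWeight Rs κ u)
      ≤ ∫⁻ _ in ball x r, ENNReal.ofReal (M * dunklWeight Rs κ w) :=
        setLIntegral_mono' measurableSet_ball fun u hu => ENNReal.ofReal_le_ofReal (hx u hu)
    _ = ENNReal.ofReal (M * c⁻¹ ^ N) *
          ∫⁻ _ in ball w (c * r), ENNReal.ofReal (dunklWeight Rs κ w) := by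
        rw [setLIntegral_const, setLIntegral_const, hvol, ← mul_assoc, ← mul_assoc,
          ← ENNReal.ofReal_mul (by positivity), ← ENNReal.ofReal_mul (by positivity)]
        ring_nf
    _ ≤ ENNReal.ofReal (M * c⁻¹ ^ N) *
          ∫⁻ z in ball w (c * r), ENNReal.ofReal M * ENNReal.ofReal (dunklWeight Rs κ z) := by
        refine mul_le_mul_right ?_ _
        refine setLIntegral_mono' measurableSet_ball fun z hz => ?_
        rw [← ENNReal.ofReal_mul hM]
        exact ENNReal.ofReal_le_ofReal (hw z hz)
    _ = _ := by
        rw [lintegral_const_mul' _ _ ENNReal.ofReal_ne_top, ← mul_assoc,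
          ← ENNReal.ofReal_mul (by positivity)]
        ring_nf

/-- ω(B(x,r)) ≈ ω(B(y,r)) whenever ‖x - y‖ ≤ r. -/
theorem dunklMeasure_ball_comparable
    (Rs : Finset (EuclideanSpace ℝ (Fin N))) (κ : EuclideanSpace ℝ (Fin N) → ℝ)
    (hN : 1 ≤ N)
    (hnorm : ∀ α ∈ Rs, ⟪α, α⟫ = (2 : ℝ))
    (hRinv : ∀ α ∈ Rs, ∀ β ∈ Rs, dunklReflect α β ∈ Rs)
    (hκ0 : ∀ α ∈ Rs, 0 ≤ κ α)
    (hκinv : ∀ α ∈ Rs, ∀ β ∈ Rs, κ (dunklReflect α β) = κ β) :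
    ∃ C : ℝ, 1 ≤ C ∧ ∀ (x y : EuclideanSpace ℝ (Fin N)) (r : ℝ), 0 < r → ‖x - y‖ ≤ r →
      ENNReal.ofReal C⁻¹ * dunklMeasure Rs κ (ball y r) ≤ dunklMeasure Rs κ (ball x r) ∧
        dunklMeasure Rs κ (ball x r) ≤ ENNReal.ofReal C * dunklMeasure Rs κ (ball y r) := by
  have hnorm2 : ∀ α ∈ Rs, ‖α‖ ≤ 2 := fun α hα => by
    have h := hnorm α hα
    rw [real_inner_self_eq_norm_sq] at h
    nlinarith [norm_nonneg α]
  have hne : ∀ α ∈ Rs, α ≠ 0 := by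
    rintro α hα rfl
    simpa using hnorm 0 hα
  obtain ⟨c, hc0, hc1, hc⟩ := exists_subball_forall_le_abs_inner Rs hne
  set M : ℝ := ∏ α ∈ Rs, (1 + 6 / c) ^ κ α
  have hM : 1 ≤ M := Finset.one_le_prod fun α hα =>
    Real.one_le_rpow (le_add_of_nonneg_right (by positivity)) (hκ0 α hα)
  have hC : 1 ≤ M ^ 2 * c⁻¹ ^ N :=
    one_le_mul_of_one_le_of_one_le (one_le_pow₀ hM) (one_le_pow₀ ((one_le_inv₀ hc0).2 hc1))
  have key : ∀ (x y : EuclideanSpace ℝ (Fin N)) (r : ℝ), 0 < r → ‖x - y‖ ≤ r →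
      dunklMeasure Rs κ (ball x r) ≤
        ENNReal.ofReal (M ^ 2 * c⁻¹ ^ N) * dunklMeasure Rs κ (ball y r) := by
    intro x y r hr hxy
    obtain ⟨w, hwy, hw⟩ := hc y r hr
    have hww : w ∈ ball w (c * r) := mem_ball_self (by positivity)
    have hweight : ∀ u ∈ ball y (2 * r), ∀ z ∈ ball w (c * r),
        dunklWeight Rs κ u ≤ M * dunklWeight Rs κ z := by
      intro u hu z hz
      refine dunklWeight_le_mul hκ0 (by positivity) fun α hα => ?_
      have huz : ‖u - z‖ ≤ 3 * r := by
        rw [← dist_eq_norm]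
        linarith [dist_triangle_right u z y, mem_ball.1 hu, mem_ball.1 (hwy hz)]
      calc ‖α‖ * ‖u - z‖ ≤ 2 * (3 * r) :=
            mul_le_mul (hnorm2 α hα) huz (norm_nonneg _) zero_le_two
        _ = 6 / c * (c * r) := by field_simp; ring
        _ ≤ 6 / c * |⟪α, z⟫| := by
            gcongr
            exact hw z hz α hα
    refine (dunklMeasure_ball_le hc0 hr (zero_le_one.trans hM)
      (fun u hu => hweight u ?_ w hww) (fun z hz => hweight w ?_ z hz)).trans ?_
    · refine ball_subset_ball' ?_ hu
      rw [dist_eq_norm]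
      linarith
    · exact ball_subset_ball (by linarith) (hwy hww)
    · gcongr
  refine ⟨M ^ 2 * c⁻¹ ^ N, hC, fun x y r hr hxy => ⟨?_, key x y r hr hxy⟩⟩
  have hC0 := zero_lt_one.trans_le hC
  calc ENNReal.ofReal (M ^ 2 * c⁻¹ ^ N)⁻¹ * dunklMeasure Rs κ (ball y r)
      ≤ ENNReal.ofReal (M ^ 2 * c⁻¹ ^ N)⁻¹ *
          (ENNReal.ofReal (M ^ 2 * c⁻¹ ^ N) * dunklMeasure Rs κ (ball x r)) := by
        gcongr
        exact key y x r hr (by rwa [norm_sub_rev])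
    _ = dunklMeasure Rs κ (ball x r) := by
        rw [← mul_assoc, ← ENNReal.ofReal_mul (by positivity), inv_mul_cancel₀ hC0.ne',
          ENNReal.ofReal_one, one_mul]
end
end

section
/- There exists a constant C ≥ 1, depending only on the root system R and the multiplicity function κ, such that for all x, y ∈ ℝ^N and r > 0 with d(x,y) ≤ r, one has C^{-1} · ω(O(B(y,r))) ≤ ω(O(B(x,r))) ≤ C · ω(O(B(y,r))). -/
open MeasureTheory Metric
open scoped ENNReal RealInnerProductSpace NNReal

noncomputable section

variable {N : ℕ}

theorem abs_inner_le_two_mul_norm {α : EuclideanSpace ℝ (Fin N)} (hnorm : ⟪α, α⟫ = (2 : ℝ))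
    (x : EuclideanSpace ℝ (Fin N)) : |⟪α, x⟫| ≤ 2 * ‖x‖ := by
  refine (abs_real_inner_le_norm α x).trans (mul_le_mul_of_nonneg_right ?_ (norm_nonneg x))
  nlinarith [norm_nonneg α, real_inner_self_eq_norm_sq α]

theorem exists_mem_dunklGroup_coe_eq_dunklReflect {Rs : Finset (EuclideanSpace ℝ (Fin N))}
    {α : EuclideanSpace ℝ (Fin N)} (hα : α ∈ Rs) (hnorm : ⟪α, α⟫ = (2 : ℝ)) :
    ∃ σ : dunklGroup Rs, ⇑σ.1 = dunklReflect α := by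
  have h : ⇑((ℝ ∙ α)ᗮ.reflection) = dunklReflect α := by
    ext1 x
    rw [Submodule.reflection_orthogonal_apply, Submodule.reflection_singleton_apply, dunklReflect]
    have h2 : ((‖α‖ : ℝ) ^ 2) = 2 := by rw [← real_inner_self_eq_norm_sq, hnorm]
    simp only [RCLike.ofReal_real_eq_id, id_eq, h2]
    module
  exact ⟨⟨_, Subgroup.subset_closure ⟨α, hα, h⟩⟩, h⟩

theorem dunklDist_lt_iff {Rs : Finset (EuclideanSpace ℝ (Fin N))} [Finite (dunklGroup Rs)]
    {x y : EuclideanSpace ℝ (Fin N)} {r : ℝ} :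
    dunklDist Rs x y < r ↔ ∃ σ : dunklGroup Rs, ‖x - σ.1 y‖ < r :=
  ciInf_lt_iff (Set.finite_range _).bddBelow

theorem exists_norm_sub_le_of_dunklDist_le {Rs : Finset (EuclideanSpace ℝ (Fin N))}
    [Finite (dunklGroup Rs)] {x y : EuclideanSpace ℝ (Fin N)} {r : ℝ}
    (h : dunklDist Rs x y ≤ r) : ∃ σ : dunklGroup Rs, ‖x - σ.1 y‖ ≤ r := by
  obtain ⟨σ, hσ⟩ := exists_eq_ciInf_of_finite (f := fun σ : dunklGroup Rs => ‖x - σ.1 y‖)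
  exact ⟨σ, hσ.trans_le h⟩

theorem norm_sub_apply_eq_norm_inv_apply_sub
    (σ : EuclideanSpace ℝ (Fin N) ≃ₗᵢ[ℝ] EuclideanSpace ℝ (Fin N))
    (x y : EuclideanSpace ℝ (Fin N)) : ‖x - σ y‖ = ‖σ⁻¹ x - y‖ := by
  rw [← σ.norm_map (σ⁻¹ x - y), map_sub]
  congr 2
  exact (σ.apply_symm_apply x).symm

theorem dunklBall_eq_iUnion_ball (Rs : Finset (EuclideanSpace ℝ (Fin N)))
    [Finite (dunklGroup Rs)] (x : EuclideanSpace ℝ (Fin N)) (r : ℝ) :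
    dunklBall Rs x r = ⋃ σ : dunklGroup Rs, ball (σ.1 x) r := by
  ext y
  simp only [dunklBall, Set.mem_ofPred_eq, dunklDist_lt_iff, Set.mem_iUnion, mem_ball']
  constructor
  · rintro ⟨σ, h⟩
    exact ⟨σ⁻¹, by rwa [dist_eq_norm, Subgroup.coe_inv, ← norm_sub_apply_eq_norm_inv_apply_sub]⟩
  · rintro ⟨σ, h⟩
    refine ⟨σ⁻¹, ?_⟩
    rwa [norm_sub_apply_eq_norm_inv_apply_sub, Subgroup.coe_inv, inv_inv, ← dist_eq_norm]

/-- There is a vector of norm at most `1/2` whose whole orbit stays away from all the mirrors. -/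
theorem exists_orbit_inner_bounded_below (Rs : Finset (EuclideanSpace ℝ (Fin N)))
    [Finite (dunklGroup Rs)] (hnorm : ∀ α ∈ Rs, ⟪α, α⟫ = (2 : ℝ)) :
    ∃ v : EuclideanSpace ℝ (Fin N), ‖v‖ ≤ 1 / 2 ∧ ∃ c : ℝ, 0 < c ∧
      ∀ α ∈ Rs, ∀ σ : dunklGroup Rs, c ≤ |⟪α, σ.1 v⟫| := by
  obtain ⟨w, hw⟩ := Module.Dual.exists_forall_ne_zero_of_forall_exists
    (fun p : Rs × dunklGroup Rs =>
      (innerSL ℝ p.1.1).toLinearMap ∘ₗ p.2.1.toLinearEquiv.toLinearMap) (by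
        rintro ⟨⟨α, hα⟩, σ⟩
        refine ⟨σ.1.symm α, ?_⟩
        have hα0 : α ≠ 0 := by
          rintro rfl
          simpa using hnorm 0 hα
        simpa using hα0)
  have hs : 0 < 1 / (2 * (‖w‖ + 1)) := by positivity
  set v := (1 / (2 * (‖w‖ + 1))) • w with hv
  have hne : ∀ p : Rs × dunklGroup Rs, 0 < |⟪p.1.1, p.2.1 v⟫| := fun p => by
    have := hw p
    simp only [LinearMap.comp_apply] at this
    rw [hv, map_smul, inner_smul_right, abs_pos]
    exact mul_ne_zero hs.ne' this
  refine ⟨v, ?_, ?_⟩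
  · rw [hv, norm_smul, Real.norm_of_nonneg hs.le, div_mul_eq_mul_div, one_mul,
      div_le_div_iff₀ (by positivity) two_pos]
    linarith
  · cases isEmpty_or_nonempty (Rs × dunklGroup Rs) with
    | inl h => exact ⟨1, one_pos, fun α hα σ => (h.false (⟨α, hα⟩, σ)).elim⟩
    | inr h =>
      obtain ⟨p, hp⟩ := Finite.exists_min fun p : Rs × dunklGroup Rs => |⟪p.1.1, p.2.1 v⟫|
      exact ⟨_, hne p, fun α hα σ => hp (⟨α, hα⟩, σ)⟩

/-- Every orbit meets the closed Weyl chamber of a given point. -/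
theorem exists_dunklGroup_inner_mul_inner_nonneg (Rs : Finset (EuclideanSpace ℝ (Fin N)))
    [Finite (dunklGroup Rs)] (hnorm : ∀ α ∈ Rs, ⟪α, α⟫ = (2 : ℝ))
    (v x : EuclideanSpace ℝ (Fin N)) :
    ∃ σ : dunklGroup Rs, ∀ α ∈ Rs, 0 ≤ ⟪α, σ.1 v⟫ * ⟪α, x⟫ := by
  obtain ⟨σ, hσ⟩ := Finite.exists_max fun σ : dunklGroup Rs => ⟪σ.1 v, x⟫
  refine ⟨σ, fun α hα => ?_⟩
  obtain ⟨τ, hτ⟩ := exists_mem_dunklGroup_coe_eq_dunklReflect hα (hnorm α hα)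
  have h := hσ (τ * σ)
  have h1 : (τ * σ).1 v = dunklReflect α (σ.1 v) := by rw [← hτ]; rfl
  rw [h1, dunklReflect, inner_sub_left, real_inner_smul_left] at h
  linarith

/-- Every ball contains a ball of comparable radius on which all root functionals are as large as
they can be on the original ball, up to a constant factor. -/
theorem exists_subball_inner_bounded_below (Rs : Finset (EuclideanSpace ℝ (Fin N)))
    [Finite (dunklGroup Rs)] (hnorm : ∀ α ∈ Rs, ⟪α, α⟫ = (2 : ℝ)) :
    ∃ δ : ℝ, 0 < δ ∧ ∀ (x : EuclideanSpace ℝ (Fin N)) (r : ℝ), 0 < r → ∃ z,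
      ball z (δ * r) ⊆ ball x r ∧
        ∀ w ∈ ball z (δ * r), ∀ α ∈ Rs, δ * (|⟪α, x⟫| + r) ≤ |⟪α, w⟫| := by
  obtain ⟨v, hv, c, hc, hcv⟩ := exists_orbit_inner_bounded_below Rs hnorm
  refine ⟨min (1 / 2) (c / 4), by positivity, fun x r hr => ?_⟩
  set δ := min (1 / 2) (c / 4)
  have hδ1 : δ ≤ 1 / 2 := min_le_left _ _
  have hδ2 : δ ≤ c / 4 := min_le_right _ _
  obtain ⟨σ, hσ⟩ := exists_dunklGroup_inner_mul_inner_nonneg Rs hnorm v x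
  refine ⟨x + r • σ.1 v, ball_subset_ball' ?_, fun w hw α hα => ?_⟩
  · rw [dist_eq_norm, add_sub_cancel_left, norm_smul, LinearIsometryEquiv.norm_map,
      Real.norm_of_nonneg hr.le]
    nlinarith
  · have hz : |⟪α, x + r • σ.1 v⟫| = |⟪α, x⟫| + r * |⟪α, σ.1 v⟫| := by
      rw [inner_add_right, real_inner_smul_right, ← abs_of_pos hr, ← abs_mul, abs_of_pos hr,
        abs_add_eq_add_abs_iff]
      have h := hσ α hα
      rcases mul_nonneg_iff.1 h with h | h
      · exact Or.inl ⟨h.2, mul_nonneg hr.le h.1⟩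
      · exact Or.inr ⟨h.2, mul_nonpos_of_nonneg_of_nonpos hr.le h.1⟩
    have hd : |⟪α, x + r • σ.1 v - w⟫| ≤ 2 * (δ * r) := by
      refine (abs_inner_le_two_mul_norm (hnorm α hα) _).trans ?_
      rw [mem_ball', dist_eq_norm] at hw
      exact mul_le_mul_of_nonneg_left hw.le two_pos.le
    rw [inner_sub_right] at hd
    have h1 := abs_sub_abs_le_abs_sub ⟪α, x + r • σ.1 v⟫ ⟪α, w⟫
    have h2 := mul_le_mul_of_nonneg_left (hcv α hα σ) hr.le
    have h3 := mul_le_mul_of_nonneg_right hδ1 (abs_nonneg ⟪α, x⟫)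
    have h4 := mul_le_mul_of_nonneg_right hδ2 hr.le
    have h5 := abs_nonneg ⟪α, x⟫
    have h6 := mul_pos hr hc
    linarith

theorem dunklMeasure_ball_two_mul_le (Rs : Finset (EuclideanSpace ℝ (Fin N)))
    (κ : EuclideanSpace ℝ (Fin N) → ℝ) [Finite (dunklGroup Rs)]
    (hnorm : ∀ α ∈ Rs, ⟪α, α⟫ = (2 : ℝ)) (hκ0 : ∀ α ∈ Rs, 0 ≤ κ α) :
    ∃ C : ℝ, 0 < C ∧ ∀ (x : EuclideanSpace ℝ (Fin N)) (r : ℝ), 0 < r →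
      dunklMeasure Rs κ (ball x (2 * r)) ≤ ENNReal.ofReal C * dunklMeasure Rs κ (ball x r) := by
  obtain ⟨δ, hδ, hsub⟩ := exists_subball_inner_bounded_below Rs hnorm
  refine ⟨(∏ α ∈ Rs, (5 / δ) ^ κ α) * (2 / δ) ^ N, by positivity, fun x r hr => ?_⟩
  obtain ⟨z, hzx, hz⟩ := hsub x r hr
  have hup : ∀ w ∈ ball x (2 * r),
      dunklWeight Rs κ w ≤ ∏ α ∈ Rs, (5 * (|⟪α, x⟫| + r)) ^ κ α := fun w hw => by
    refine Finset.prod_le_prod (fun α _ => by positivity) fun α hα =>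
      Real.rpow_le_rpow (abs_nonneg _) ?_ (hκ0 α hα)
    have hd : |⟪α, w - x⟫| ≤ 2 * (2 * r) := by
      refine (abs_inner_le_two_mul_norm (hnorm α hα) _).trans ?_
      rw [mem_ball, dist_eq_norm] at hw
      exact mul_le_mul_of_nonneg_left hw.le two_pos.le
    rw [inner_sub_right] at hd
    have h1 := abs_sub_abs_le_abs_sub ⟪α, w⟫ ⟪α, x⟫
    have h2 := abs_nonneg ⟪α, x⟫
    linarith
  have hlow : ∀ w ∈ ball z (δ * r), ∏ α ∈ Rs, (5 * (|⟪α, x⟫| + r)) ^ κ α ≤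
      (∏ α ∈ Rs, (5 / δ) ^ κ α) * dunklWeight Rs κ w := fun w hw => by
    rw [dunklWeight, ← Finset.prod_mul_distrib]
    refine Finset.prod_le_prod (fun α _ => by positivity) fun α hα => ?_
    rw [← Real.mul_rpow (by positivity) (by positivity)]
    refine Real.rpow_le_rpow (by positivity) ?_ (hκ0 α hα)
    rw [div_mul_eq_mul_div, le_div_iff₀ hδ]
    linarith [hz w hw α hα]
  set M := ∏ α ∈ Rs, (5 * (|⟪α, x⟫| + r)) ^ κ α
  set K := ∏ α ∈ Rs, (5 / δ) ^ κ α with hK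
  have hKpos : 0 < K := by positivity
  have hvol : volume (ball x (2 * r)) =
      ENNReal.ofReal ((2 / δ) ^ N) * volume (ball z (δ * r)) := by
    have h := Measure.addHaar_ball_mul_of_pos
      (volume : Measure (EuclideanSpace ℝ (Fin N))) x (r := 2 / δ) (by positivity) (δ * r)
    rwa [← mul_assoc, div_mul_cancel₀ _ hδ.ne', finrank_euclideanSpace_fin,
      ← Measure.addHaar_ball_center _ z] at h
  calc dunklMeasure Rs κ (ball x (2 * r))
      = ∫⁻ w in ball x (2 * r), ENNReal.ofReal (dunklWeight Rs κ w) :=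
        withDensity_apply _ measurableSet_ball
    _ ≤ ∫⁻ _ in ball x (2 * r), ENNReal.ofReal M :=
        setLIntegral_mono' measurableSet_ball fun w hw => ENNReal.ofReal_le_ofReal (hup w hw)
    _ = ENNReal.ofReal ((2 / δ) ^ N) * ∫⁻ _ in ball z (δ * r), ENNReal.ofReal M := by
        rw [setLIntegral_const, setLIntegral_const, hvol]
        ring
    _ ≤ ENNReal.ofReal ((2 / δ) ^ N) *
          ∫⁻ w in ball z (δ * r), ENNReal.ofReal K * ENNReal.ofReal (dunklWeight Rs κ w) := by
        gcongr 1
        refine setLIntegral_mono' measurableSet_ball fun w hw => ?_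
        rw [← ENNReal.ofReal_mul hKpos.le]
        exact ENNReal.ofReal_le_ofReal (hlow w hw)
    _ = ENNReal.ofReal (K * (2 / δ) ^ N) * dunklMeasure Rs κ (ball z (δ * r)) := by
        rw [lintegral_const_mul' _ _ ENNReal.ofReal_ne_top, dunklMeasure,
          withDensity_apply _ measurableSet_ball, ENNReal.ofReal_mul hKpos.le]
        ring
    _ ≤ _ := by gcongr

theorem dunklMeasure_dunklBall_two_mul_le (Rs : Finset (EuclideanSpace ℝ (Fin N)))
    (κ : EuclideanSpace ℝ (Fin N) → ℝ) [Finite (dunklGroup Rs)]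
    (hnorm : ∀ α ∈ Rs, ⟪α, α⟫ = (2 : ℝ)) (hκ0 : ∀ α ∈ Rs, 0 ≤ κ α) :
    ∃ C : ℝ, 1 ≤ C ∧ ∀ (x : EuclideanSpace ℝ (Fin N)) (r : ℝ), 0 < r →
      dunklMeasure Rs κ (dunklBall Rs x (2 * r)) ≤
        ENNReal.ofReal C * dunklMeasure Rs κ (dunklBall Rs x r) := by
  obtain ⟨C, hC, h⟩ := dunklMeasure_ball_two_mul_le Rs κ hnorm hκ0
  have := Fintype.ofFinite (dunklGroup Rs)
  refine ⟨max 1 (Fintype.card (dunklGroup Rs) * C), le_max_left _ _, fun x r hr => ?_⟩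
  calc dunklMeasure Rs κ (dunklBall Rs x (2 * r))
      ≤ ∑ σ : dunklGroup Rs, dunklMeasure Rs κ (ball (σ.1 x) (2 * r)) := by
        rw [dunklBall_eq_iUnion_ball]
        exact measure_iUnion_fintype_le _ _
    _ ≤ ∑ _σ : dunklGroup Rs, ENNReal.ofReal C * dunklMeasure Rs κ (dunklBall Rs x r) := by
        refine Finset.sum_le_sum fun σ _ => (h _ r hr).trans ?_
        rw [dunklBall_eq_iUnion_ball Rs x r]
        gcongr
        exact Set.subset_iUnion (fun σ : dunklGroup Rs => ball (σ.1 x) r) σ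
    _ = ENNReal.ofReal (Fintype.card (dunklGroup Rs) * C) *
          dunklMeasure Rs κ (dunklBall Rs x r) := by
        rw [Finset.sum_const, Finset.card_univ, nsmul_eq_mul,
          ENNReal.ofReal_mul (Nat.cast_nonneg _), ENNReal.ofReal_natCast, mul_assoc]
    _ ≤ _ := by
        gcongr
        exact le_max_right _ _

theorem dunklBall_subset_dunklBall_two_mul {Rs : Finset (EuclideanSpace ℝ (Fin N))}
    [Finite (dunklGroup Rs)] {x y : EuclideanSpace ℝ (Fin N)} {r : ℝ} (σ : dunklGroup Rs)
    (h : ‖x - σ.1 y‖ ≤ r) : dunklBall Rs y r ⊆ dunklBall Rs x (2 * r) := by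
  intro z hz
  obtain ⟨τ, hτ⟩ := dunklDist_lt_iff.1 hz
  refine dunklDist_lt_iff.2 ⟨σ * τ, ?_⟩
  have h1 : ‖σ.1 y - (σ * τ).1 z‖ = ‖y - τ.1 z‖ := by
    rw [← σ.1.norm_map (y - τ.1 z), map_sub]
    rfl
  linarith [norm_sub_le_norm_sub_add_norm_sub x (σ.1 y) ((σ * τ).1 z)]

/-- ω(O(B(x,r))) ≈ ω(O(B(y,r))) whenever d(x,y) ≤ r. -/
theorem dunklMeasure_orbitBall_comparable
    (Rs : Finset (EuclideanSpace ℝ (Fin N))) (κ : EuclideanSpace ℝ (Fin N) → ℝ)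
    (hN : 1 ≤ N)
    (hnorm : ∀ α ∈ Rs, ⟪α, α⟫ = (2 : ℝ))
    (hRinv : ∀ α ∈ Rs, ∀ β ∈ Rs, dunklReflect α β ∈ Rs)
    (hκ0 : ∀ α ∈ Rs, 0 ≤ κ α)
    (hκinv : ∀ α ∈ Rs, ∀ β ∈ Rs, κ (dunklReflect α β) = κ β)
    (hGfin : Finite (dunklGroup Rs)) :
    ∃ C : ℝ, 1 ≤ C ∧ ∀ (x y : EuclideanSpace ℝ (Fin N)) (r : ℝ), 0 < r →
      dunklDist Rs x y ≤ r →
      ENNReal.ofReal C⁻¹ * dunklMeasure Rs κ (dunklBall Rs y r) ≤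
          dunklMeasure Rs κ (dunklBall Rs x r) ∧
        dunklMeasure Rs κ (dunklBall Rs x r) ≤
          ENNReal.ofReal C * dunklMeasure Rs κ (dunklBall Rs y r) := by
  obtain ⟨C, hC, h⟩ := dunklMeasure_dunklBall_two_mul_le Rs κ hnorm hκ0
  refine ⟨C, hC, fun x y r hr hxy => ?_⟩
  obtain ⟨σ, hσ⟩ := exists_norm_sub_le_of_dunklDist_le hxy
  have hσ' : ‖y - (σ⁻¹).1 x‖ ≤ r := by
    rwa [norm_sub_rev, Subgroup.coe_inv, ← norm_sub_apply_eq_norm_inv_apply_sub]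
  have hC0 : 0 < C := one_pos.trans_le hC
  constructor
  · rw [ENNReal.ofReal_inv_of_pos hC0, mul_comm, ← div_eq_mul_inv]
    refine ENNReal.div_le_of_le_mul' ?_
    exact (measure_mono (dunklBall_subset_dunklBall_two_mul σ hσ)).trans (h x r hr)
  · exact (measure_mono (dunklBall_subset_dunklBall_two_mul σ⁻¹ hσ')).trans (h y r hr)
end
end
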